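/- arXiv:2206.07845 — 5 statements merged into one kernel-verified Lean document; each statement's English description precedes it below -/
import Mathlib

section
/- Let m ≥ 2 and let x_1 ≤ x_2 ≤ ⋯ ≤ x_{2m} be real numbers. Then for every permutation π of {1, …, 2m}, ∑_{k=1}^{m} x_{π(2k−1)} · x_{π(2k)} ≤ ∑_{k=1}^{m} x_{2k−1} · x_{2k}; i.e., among all ways of partitioning the 2m numbers into m pairs, pairing adjacent elements of the sorted list maximizes the sum of within-pair products. -/
/-- The multiset of all entries of a multiset of pairs. -/
def pairEntries (P : Multiset (ℝ × ℝ)) : Multiset ℝ := P.map Prod.fst + P.map Prod.snd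

/-- The sum of the products within the pairs of a multiset of pairs. -/
def pairProductSum (P : Multiset (ℝ × ℝ)) : ℝ := (P.map fun p => p.1 * p.2).sum

lemma pairEntries_cons (p : ℝ × ℝ) (P : Multiset (ℝ × ℝ)) :
    pairEntries (p ::ₘ P) = p.1 ::ₘ p.2 ::ₘ pairEntries P := by
  simp [pairEntries, Multiset.cons_swap p.1]

lemma pairProductSum_cons (p : ℝ × ℝ) (P : Multiset (ℝ × ℝ)) :
    pairProductSum (p ::ₘ P) = p.1 * p.2 + pairProductSum P := by
  simp [pairProductSum]

/-- An entry of a multiset of pairs can be split off together with its partner. -/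
lemma exists_partner_of_mem_pairEntries {P : Multiset (ℝ × ℝ)} {a : ℝ}
    (ha : a ∈ pairEntries P) :
    ∃ c Q, pairEntries P = a ::ₘ c ::ₘ pairEntries Q ∧
      pairProductSum P = a * c + pairProductSum Q := by
  rcases Multiset.mem_add.1 ha with h | h
  · obtain ⟨p, hp, rfl⟩ := Multiset.mem_map.1 h
    obtain ⟨Q, rfl⟩ := Multiset.exists_cons_of_mem hp
    exact ⟨p.2, Q, pairEntries_cons p Q, pairProductSum_cons p Q⟩
  · obtain ⟨p, hp, rfl⟩ := Multiset.mem_map.1 h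
    obtain ⟨Q, rfl⟩ := Multiset.exists_cons_of_mem hp
    refine ⟨p.1, Q, ?_, ?_⟩
    · rw [pairEntries_cons, Multiset.cons_swap]
    · rw [pairProductSum_cons, mul_comm]

lemma map_range_two_mul_succ (x : ℕ → ℝ) (m : ℕ) :
    (Multiset.range (2 * (m + 1))).map x =
      x (2 * m + 1) ::ₘ x (2 * m) ::ₘ (Multiset.range (2 * m)).map x := by
  rw [show 2 * (m + 1) = 2 * m + 1 + 1 by ring]
  simp [Multiset.range_succ]

/-- The even-indexed and odd-indexed terms of a finite sequence together are all its terms. -/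
lemma pairEntries_map_range (x : ℕ → ℝ) (m : ℕ) :
    pairEntries ((Multiset.range m).map fun k => (x (2 * k), x (2 * k + 1))) =
      (Multiset.range (2 * m)).map x := by
  induction m with
  | zero => simp [pairEntries]
  | succ m ih =>
    rw [map_range_two_mul_succ, Multiset.range_succ, Multiset.map_cons, pairEntries_cons, ih,
      Multiset.cons_swap]

theorem pairProductSum_le_sum_adjacent (m : ℕ) (x : ℕ → ℝ)
    (hx : ∀ i j, i ≤ j → j < 2 * m → x i ≤ x j) (P : Multiset (ℝ × ℝ))
    (hP : pairEntries P = (Multiset.range (2 * m)).map x) :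
    pairProductSum P ≤ ∑ k ∈ Finset.range m, x (2 * k) * x (2 * k + 1) := by
  induction m generalizing P with
  | zero =>
    have h0 : P = 0 := by
      have := congrArg Multiset.card hP
      simp [pairEntries] at this
      exact this
    simp [h0, pairProductSum]
  | succ m ih =>
    have ih' := ih fun i j hij hj => hx i j hij (by omega)
    rw [map_range_two_mul_succ] at hP
    rw [Finset.sum_range_succ]
    obtain ⟨c, Q, hQ, hsQ⟩ := exists_partner_of_mem_pairEntries (P := P) (a := x (2 * m + 1))
      (by rw [hP]; exact Multiset.mem_cons_self _ _)
    rw [hQ, Multiset.cons_inj_right] at hP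
    by_cases hc : c = x (2 * m)
    · rw [hc, Multiset.cons_inj_right] at hP
      have := ih' Q hP
      rw [hsQ, hc]
      linarith
    · have hb : x (2 * m) ∈ pairEntries Q := by
        have : x (2 * m) ∈ c ::ₘ pairEntries Q := by
          rw [hP]; exact Multiset.mem_cons_self _ _
        exact (Multiset.mem_cons.1 this).resolve_left (Ne.symm hc)
      obtain ⟨d, R, hR, hsR⟩ := exists_partner_of_mem_pairEntries hb
      rw [hR, Multiset.cons_swap, Multiset.cons_inj_right] at hP
      have le_of_mem : ∀ y ∈ (Multiset.range (2 * m)).map x, y ≤ x (2 * m) := by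
        intro y hy
        obtain ⟨i, hi, rfl⟩ := Multiset.mem_map.1 hy
        exact hx _ _ (Multiset.mem_range.1 hi).le (by omega)
      have hcb : c ≤ x (2 * m) := le_of_mem c (by simp [← hP])
      have hdb : d ≤ x (2 * m) := le_of_mem d (by simp [← hP])
      have hba : x (2 * m) ≤ x (2 * m + 1) := hx _ _ (by omega) (by omega)
      have := ih' ((c, d) ::ₘ R) (by rw [pairEntries_cons, hP])
      rw [pairProductSum_cons] at this
      rw [hsQ, hsR]
      dsimp only at this
      nlinarith [mul_nonneg (sub_nonneg.2 (hdb.trans hba)) (sub_nonneg.2 hcb)]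

/-- Among all ways of partitioning `2*m` sorted real numbers into `m` pairs, pairing
adjacent elements of the sorted list maximizes the sum of within-pair products. -/
theorem stmt_0 (m : ℕ) (hm : 2 ≤ m) (x : Fin (2 * m) → ℝ) (hx : Monotone x)
    (π : Equiv.Perm (Fin (2 * m))) :
    ∑ k : Fin m, x (π ⟨2 * k.1, by have := k.isLt; omega⟩) *
        x (π ⟨2 * k.1 + 1, by have := k.isLt; omega⟩) ≤
      ∑ k : Fin m, x ⟨2 * k.1, by have := k.isLt; omega⟩ *
        x ⟨2 * k.1 + 1, by have := k.isLt; omega⟩ := by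
  let ext (f : Fin (2 * m) → ℝ) (i : ℕ) : ℝ := if h : i < 2 * m then f ⟨i, h⟩ else 0
  have ext_eq (f : Fin (2 * m) → ℝ) (i : ℕ) (h : i < 2 * m) : ext f i = f ⟨i, h⟩ := dif_pos h
  have map_ext (f : Fin (2 * m) → ℝ) :
      (Multiset.range (2 * m)).map (ext f) = Finset.univ.val.map f := by
    rw [Multiset.range, ← List.map_coe_finRange_eq_range, Multiset.map_coe, List.map_map]
    change _ = Multiset.map f (List.finRange (2 * m) : Multiset _)
    rw [Multiset.map_coe]
    congr 2
    funext i
    exact ext_eq f i i.2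
  have sum_ext (f : Fin (2 * m) → ℝ) :
      ∑ k ∈ Finset.range m, ext f (2 * k) * ext f (2 * k + 1) =
        ∑ k : Fin m, f ⟨2 * k.1, by have := k.isLt; omega⟩ *
          f ⟨2 * k.1 + 1, by have := k.isLt; omega⟩ := by
    rw [Finset.sum_range]
    refine Finset.sum_congr rfl fun k _ => ?_
    rw [ext_eq, ext_eq]
  have key := pairProductSum_le_sum_adjacent m (ext x)
    (fun i j hij hj => by
      rw [ext_eq x i (by omega), ext_eq x j hj]
      exact hx hij)
    ((Multiset.range m).map fun k => (ext (x ∘ π) (2 * k), ext (x ∘ π) (2 * k + 1)))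
    (by
      rw [pairEntries_map_range, map_ext, map_ext, ← Multiset.map_map]
      congr 1
      exact congrArg Finset.val (Finset.map_univ_equiv π))
  rw [sum_ext, pairProductSum, Multiset.map_map] at key
  exact (sum_ext (x ∘ π)).symm.trans_le key
end

section
/- Let m ≥ 2 and let x_1 ≤ x_2 ≤ ⋯ ≤ x_{2m} be real numbers. Then for every permutation π of {1, …, 2m}, ∑_{k=1}^{m} (x_{2k−1} − x_{2k})² ≤ ∑_{k=1}^{m} (x_{π(2k−1)} − x_{π(2k)})²; i.e., among all ways of partitioning the 2m numbers into m pairs, pairing adjacent elements of the sorted list minimizes the sum of within-pair squared differences. -/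
/-- The sum of squared differences of consecutive disjoint pairs of a list. -/
def adjacentPairCost : List ℝ → ℝ
  | a :: b :: t => (a - b) ^ 2 + adjacentPairCost t
  | _ => 0

theorem ofFn_two_mul_succ {α : Type*} (m : ℕ) (x : Fin (2 * (m + 1)) → α) :
    List.ofFn x = x ⟨0, by omega⟩ :: x ⟨1, by omega⟩ ::
      List.ofFn (fun i : Fin (2 * m) => x ⟨i.1 + 2, by have := i.isLt; omega⟩) := by
  change List.ofFn (n := 2 * m + 1 + 1) x = _
  rw [List.ofFn_succ, List.ofFn_succ]
  rfl

theorem adjacentPairCost_ofFn (m : ℕ) (x : Fin (2 * m) → ℝ)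
    (h₀ : ∀ k : Fin m, 2 * k.1 < 2 * m) (h₁ : ∀ k : Fin m, 2 * k.1 + 1 < 2 * m) :
    adjacentPairCost (List.ofFn x) =
      ∑ k : Fin m, (x ⟨2 * k.1, h₀ k⟩ -
        x ⟨2 * k.1 + 1, h₁ k⟩) ^ 2 := by
  induction m with
  | zero => simp [adjacentPairCost]
  | succ m ih =>
    rw [ofFn_two_mul_succ, adjacentPairCost, ih _ (fun k => by omega) (fun k => by omega), Fin.sum_univ_succ]
    rfl

/-- An element of the union of a multiset of unordered pairs has a partner. -/
theorem exists_partner {P : Multiset (ℝ × ℝ)} {a : ℝ}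
    (ha : a ∈ P.bind fun p => p.1 ::ₘ p.2 ::ₘ 0) :
    ∃ (c : ℝ) (Q : Multiset (ℝ × ℝ)),
      (P.bind fun p => p.1 ::ₘ p.2 ::ₘ 0) = a ::ₘ c ::ₘ Q.bind (fun p => p.1 ::ₘ p.2 ::ₘ 0) ∧
      (P.map fun p => (p.1 - p.2) ^ 2).sum =
        (a - c) ^ 2 + (Q.map fun p => (p.1 - p.2) ^ 2).sum := by
  obtain ⟨⟨u, v⟩, hp, hap⟩ := Multiset.mem_bind.1 ha
  obtain ⟨Q, rfl⟩ := Multiset.exists_cons_of_mem hp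
  simp only [Multiset.mem_cons, Multiset.notMem_zero, or_false] at hap
  obtain rfl | rfl := hap
  · exact ⟨v, Q, by simp only [Multiset.cons_bind, Multiset.cons_add, zero_add], by simp⟩
  · refine ⟨u, Q, ?_, ?_⟩
    · simp only [Multiset.cons_bind, Multiset.cons_add, zero_add]
      exact Multiset.cons_swap _ _ _
    · simp only [Multiset.map_cons, Multiset.sum_cons]
      ring

theorem adjacentPairCost_le (l : List ℝ) (hl : l.Pairwise (· ≤ ·)) (P : Multiset (ℝ × ℝ))
    (h : (P.bind fun p => p.1 ::ₘ p.2 ::ₘ 0) = (l : Multiset ℝ)) :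
    adjacentPairCost l ≤ (P.map fun p => (p.1 - p.2) ^ 2).sum := by
  induction l using adjacentPairCost.induct generalizing P with
  | case1 a b t ih =>
    simp only [List.pairwise_cons, List.mem_cons, forall_eq_or_imp] at hl
    obtain ⟨⟨hab, hat⟩, hbt, ht⟩ := hl
    obtain ⟨c, Q, hQ, hsum⟩ := exists_partner (P := P) (a := a) (by rw [h]; simp)
    rw [hQ, ← Multiset.cons_coe, ← Multiset.cons_coe, Multiset.cons_inj_right] at h
    rw [adjacentPairCost, hsum]
    by_cases hcb : c = b
    · subst hcb
      rw [Multiset.cons_inj_right] at h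
      linarith [ih ht Q h]
    · have hb : b ∈ c ::ₘ Q.bind fun p => p.1 ::ₘ p.2 ::ₘ 0 := by rw [h]; simp
      obtain ⟨d, R, hR, hsum'⟩ := exists_partner
        ((Multiset.mem_cons.1 hb).resolve_left (Ne.symm hcb))
      rw [hR, Multiset.cons_swap, Multiset.cons_inj_right] at h
      have hc : c ∈ t := by rw [← Multiset.mem_coe, ← h]; simp
      have hd : d ∈ t := by rw [← Multiset.mem_coe, ← h]; simp
      have key := ih ht ((c, d) ::ₘ R)
        (by simpa only [Multiset.cons_bind, Multiset.cons_add, zero_add] using h)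
      simp only [Multiset.map_cons, Multiset.sum_cons] at key
      rw [hsum']
      nlinarith [mul_nonneg (sub_nonneg.2 (hbt c hc)) (sub_nonneg.2 (hat d hd))]
  | case2 l hne =>
    rw [adjacentPairCost]
    · refine Multiset.sum_nonneg fun y hy => ?_
      obtain ⟨p, -, rfl⟩ := Multiset.mem_map.1 hy
      positivity
    · exact hne

/-- The list of values of a function on `Fin (2 * m)` splits into consecutive pairs. -/
theorem bind_consecutive_pairs (m : ℕ) (y : Fin (2 * m) → ℝ)
    (h₀ : ∀ k : Fin m, 2 * k.1 < 2 * m) (h₁ : ∀ k : Fin m, 2 * k.1 + 1 < 2 * m) :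
    ((Finset.univ.val.map fun k : Fin m =>
      (y ⟨2 * k.1, h₀ k⟩,
        y ⟨2 * k.1 + 1, h₁ k⟩)).bind fun p => p.1 ::ₘ p.2 ::ₘ 0) =
      (List.ofFn y : Multiset ℝ) := by
  induction m with
  | zero => simp
  | succ m ih =>
    rw [ofFn_two_mul_succ, ← Multiset.cons_coe, ← Multiset.cons_coe,
      ← ih _ (fun k => by omega) (fun k => by omega), Fin.univ_succ]
    simp [Function.comp_def, mul_add]

/-- Among all ways of partitioning `2*m` sorted real numbers into `m` pairs, pairing
adjacent elements of the sorted list minimizes the sum of within-pair squared differences. -/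
theorem stmt_1 (m : ℕ) (hm : 2 ≤ m) (x : Fin (2 * m) → ℝ) (hx : Monotone x)
    (π : Equiv.Perm (Fin (2 * m))) :
    ∑ k : Fin m, (x ⟨2 * k.1, by have := k.isLt; omega⟩ -
        x ⟨2 * k.1 + 1, by have := k.isLt; omega⟩) ^ 2 ≤
      ∑ k : Fin m, (x (π ⟨2 * k.1, by have := k.isLt; omega⟩) -
        x (π ⟨2 * k.1 + 1, by have := k.isLt; omega⟩)) ^ 2 := by
  have h₀ (k : Fin m) : 2 * k.1 < 2 * m := by omega
  have h₁ (k : Fin m) : 2 * k.1 + 1 < 2 * m := by omega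
  rw [← adjacentPairCost_ofFn m x h₀ h₁]
  refine (adjacentPairCost_le _ (List.pairwise_ofFn.2 fun i j hij => hx hij.le) _
    ((bind_consecutive_pairs m (x ∘ π) h₀ h₁).trans ?_)).trans_eq ?_
  · exact Multiset.coe_eq_coe.2 (Equiv.Perm.ofFn_comp_perm π x)
  · rw [Multiset.map_map]
    rfl
end

section
/- Let I be a finite set of cardinality 2n and λ a partition of I into blocks of even cardinality. Let D^λ ∈ {0,1}^I be the random assignment that, independently across the blocks of λ, assigns value 1 to a uniformly chosen half of the elements of each block and value 0 to the rest. For each pair-partition M of I refining λ (a partition of each block of λ into two-element sets), let D^M ∈ {0,1}^I be the assignment that, independently across the pairs of M, assigns 1 to exactly one uniformly chosen element of each pair and 0 to the other. Then the probability distribution of D^λ equals the uniform mixture, over all pair-partitions M of I refining λ, of the distributions of D^M. In particular, every stratified randomization scheme with treated fraction one half in each stratum is a convex combination of matched-pair designs. -/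
/-- The partitions of `I` into pairs that refine `P`. -/
def refiningPairPartitions {I : Type*} [Fintype I] [DecidableEq I]
    (P : Finpartition (Finset.univ : Finset I)) : Finset (Finset (Finset I)) :=
  Finset.univ.filter fun M : Finset (Finset I) =>
    (∀ b ∈ M, b.card = 2) ∧ (∀ b ∈ M, ∃ c ∈ P.parts, b ⊆ c) ∧
      (∀ b ∈ M, ∀ c ∈ M, b ≠ c → Disjoint b c) ∧
      M.biUnion id = Finset.univ

/-- The assignments treating exactly half of each block of `P`. -/
def balancedAssignments {I : Type*} [Fintype I] [DecidableEq I]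
    (P : Finpartition (Finset.univ : Finset I)) : Finset (I → Bool) :=
  Finset.univ.filter fun e : I → Bool =>
    ∀ b ∈ P.parts, 2 * (b.filter fun i => e i = true).card = b.card

/-- The assignments treating exactly one element of each member of `M`. -/
def matchedAssignments {I : Type*} [Fintype I] [DecidableEq I]
    (M : Finset (Finset I)) : Finset (I → Bool) :=
  Finset.univ.filter fun e : I → Bool =>
    ∀ b ∈ M, (b.filter fun i => e i = true).card = 1

theorem card_filter_pair_eq_one_iff {I : Type*} [DecidableEq I] {i j : I} (hij : i ≠ j)
    (e : I → Bool) :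
    (({i, j} : Finset I).filter fun k => e k = true).card = 1 ↔ e j = !e i := by
  rw [Finset.filter_insert, Finset.filter_singleton]
  cases hi : e i <;> cases hj : e j <;> simp [hij]

/-- Two functions whose fibers have the same sizes differ by a permutation of the domain. -/
theorem exists_perm_of_card_fiber_eq {I X : Type*} [Fintype I] [DecidableEq X] (f g : I → X)
    (h : ∀ x, (Finset.univ.filter fun i => f i = x).card =
      (Finset.univ.filter fun i => g i = x).card) :
    ∃ σ : Equiv.Perm I, ∀ i, g (σ i) = f i := by
  have e (x : X) : {i // f i = x} ≃ {i // g i = x} :=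
    Fintype.equivOfCardEq (by simpa [Fintype.card_subtype] using h x)
  refine ⟨(Equiv.sigmaFiberEquiv f).symm.trans
    ((Equiv.sigmaCongrRight e).trans (Equiv.sigmaFiberEquiv g)), fun i => ?_⟩
  exact (e (f i) ⟨i, rfl⟩).2

section PairPartitions

variable {I : Type*} [Fintype I] [DecidableEq I]
  {P : Finpartition (Finset.univ : Finset I)} {M : Finset (Finset I)}

theorem mem_refiningPairPartitions :
    M ∈ refiningPairPartitions P ↔
      (∀ b ∈ M, b.card = 2) ∧ (∀ b ∈ M, ∃ c ∈ P.parts, b ⊆ c) ∧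
        (∀ b ∈ M, ∀ c ∈ M, b ≠ c → Disjoint b c) ∧ M.biUnion id = Finset.univ := by
  simp [refiningPairPartitions]

theorem mem_balancedAssignments {e : I → Bool} :
    e ∈ balancedAssignments P ↔
      ∀ b ∈ P.parts, 2 * (b.filter fun i => e i = true).card = b.card := by
  simp [balancedAssignments]

theorem mem_matchedAssignments {e : I → Bool} :
    e ∈ matchedAssignments M ↔ ∀ b ∈ M, (b.filter fun i => e i = true).card = 1 := by
  simp [matchedAssignments]

theorem exists_perm_of_mem_balancedAssignments {d e : I → Bool}
    (hd : d ∈ balancedAssignments P) (he : e ∈ balancedAssignments P) :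
    ∃ σ : Equiv.Perm I, (∀ b ∈ P.parts, ∀ i ∈ b, σ i ∈ b) ∧ ∀ i, e (σ i) = d i := by
  rw [mem_balancedAssignments] at hd he
  obtain ⟨σ, hσ⟩ := exists_perm_of_card_fiber_eq
    (fun i => (P.part i, d i)) (fun i => (P.part i, e i)) (by
      rintro ⟨b, v⟩
      by_cases hb : b ∈ P.parts
      · have key (f : I → Bool) : (Finset.univ.filter fun i => (P.part i, f i) = (b, v)) =
            b.filter fun i => f i = v := by
          ext i
          simp only [Finset.mem_filter, Finset.mem_univ, true_and, Prod.mk.injEq]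
          rw [P.part_eq_iff_mem hb]
        rw [key, key]
        have h₁ := hd b hb
        have h₂ := he b hb
        have h₃ := Finset.card_filter_add_card_filter_not (s := b) (fun i => d i = true)
        have h₄ := Finset.card_filter_add_card_filter_not (s := b) (fun i => e i = true)
        cases v
        · simp only [Bool.not_eq_true] at h₃ h₄
          omega
        · omega
      · have key (f : I → Bool) : (Finset.univ.filter fun i => (P.part i, f i) = (b, v)) = ∅ := by
          refine Finset.filter_eq_empty_iff.2 fun i _ h => hb ?_
          rw [← (Prod.mk.inj h).1]
          exact P.part_mem.2 (Finset.mem_univ i)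
        rw [key, key])
  refine ⟨σ, fun b hb i hi => ?_, fun i => (Prod.mk.inj (hσ i)).2⟩
  rw [← P.part_eq_iff_mem hb] at hi ⊢
  exact (Prod.mk.inj (hσ i)).1.trans hi

theorem not_mem_balancedAssignments {d : I → Bool} (hd : d ∈ balancedAssignments P) :
    (fun i => !d i) ∈ balancedAssignments P := by
  rw [mem_balancedAssignments] at hd ⊢
  intro b hb
  have h₁ := hd b hb
  have h₃ := Finset.card_filter_add_card_filter_not (s := b) (fun i => d i = true)
  simp only [Bool.not_eq_true, Bool.not_eq_true'] at h₃ ⊢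
  omega

theorem refiningPairPartitions_nonempty {d : I → Bool} (hd : d ∈ balancedAssignments P) :
    (refiningPairPartitions P).Nonempty := by
  obtain ⟨σ, hσ, hflip⟩ :=
    exists_perm_of_mem_balancedAssignments hd (not_mem_balancedAssignments hd)
  refine ⟨(Finset.univ.filter fun i => d i = true).image fun i => {i, σ i},
    mem_refiningPairPartitions.2 ⟨?_, ?_, ?_, ?_⟩⟩
  · simp only [Finset.mem_image, Finset.mem_filter, Finset.mem_univ, true_and]
    rintro _ ⟨i, hi, rfl⟩
    refine Finset.card_pair fun h => ?_
    have := hflip i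
    rw [← h] at this
    simp at this
  · simp only [Finset.mem_image, Finset.mem_filter, Finset.mem_univ, true_and]
    rintro _ ⟨i, hi, rfl⟩
    have hmem := P.mem_part (Finset.mem_univ i)
    have hpart := P.part_mem.2 (Finset.mem_univ i)
    refine ⟨P.part i, hpart, ?_⟩
    simp [Finset.insert_subset_iff, hmem, hσ _ hpart i hmem]
  · simp only [Finset.mem_image, Finset.mem_filter, Finset.mem_univ, true_and]
    rintro _ ⟨i, hi, rfl⟩ _ ⟨j, hj, rfl⟩ hne
    have hij : i ≠ j := by
      rintro rfl
      exact hne rfl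
    have hi' := hflip i
    have hj' := hflip j
    have h₁ : i ≠ σ j := by
      intro h
      simp_all
    have h₂ : σ i ≠ j := by
      intro h
      simp_all
    simp [hij.symm, h₁.symm, h₂.symm]
  · ext i
    simp only [Finset.mem_biUnion, Finset.mem_image, Finset.mem_filter, Finset.mem_univ,
      true_and, id, iff_true]
    cases hi : d i
    · refine ⟨_, ⟨σ.symm i, ?_, rfl⟩, by simp⟩
      have := hflip (σ.symm i)
      simp_all
    · exact ⟨_, ⟨i, hi, rfl⟩, by simp⟩

theorem image_mem_refiningPairPartitions (hM : M ∈ refiningPairPartitions P)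
    (σ : Equiv.Perm I) (hσ : ∀ b ∈ P.parts, ∀ i ∈ b, σ i ∈ b) :
    M.image (Finset.image σ) ∈ refiningPairPartitions P := by
  obtain ⟨hcard, hsub, hdisj, hcover⟩ := mem_refiningPairPartitions.1 hM
  refine mem_refiningPairPartitions.2 ⟨?_, ?_, ?_, ?_⟩
  · simp only [Finset.forall_mem_image]
    intro b hb
    rw [Finset.card_image_of_injective _ σ.injective, hcard b hb]
  · simp only [Finset.forall_mem_image]
    intro b hb
    obtain ⟨c, hc, hbc⟩ := hsub b hb
    exact ⟨c, hc, Finset.image_subset_iff.2 fun i hi => hσ c hc i (hbc hi)⟩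
  · simp only [Finset.forall_mem_image]
    intro b hb c hc hne
    exact (Finset.disjoint_image σ.injective).2 (hdisj b hb c hc fun h => hne (h ▸ rfl))
  · ext i
    have hi : σ.symm i ∈ M.biUnion id := hcover ▸ Finset.mem_univ _
    obtain ⟨b, hb, hib⟩ := Finset.mem_biUnion.1 hi
    simp only [Finset.mem_biUnion, Finset.mem_univ, iff_true, id]
    exact ⟨b.image σ, Finset.mem_image_of_mem _ hb, Finset.mem_image.2 ⟨_, hib, by simp⟩⟩

theorem card_filter_mem_matchedAssignments_le {d e : I → Bool}
    (hd : d ∈ balancedAssignments P) (he : e ∈ balancedAssignments P) :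
    ((refiningPairPartitions P).filter fun M => d ∈ matchedAssignments M).card ≤
      ((refiningPairPartitions P).filter fun M => e ∈ matchedAssignments M).card := by
  obtain ⟨σ, hσ, hde⟩ := exists_perm_of_mem_balancedAssignments hd he
  refine Finset.card_le_card_of_injOn (fun M => M.image (Finset.image σ)) (fun M hM => ?_)
    (Finset.image_injective (Finset.image_injective σ.injective)).injOn
  obtain ⟨hM, hdM⟩ := Finset.mem_filter.1 hM
  refine Finset.mem_filter.2 ⟨image_mem_refiningPairPartitions hM σ hσ, ?_⟩
  rw [mem_matchedAssignments] at hdM ⊢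
  simp only [Finset.forall_mem_image]
  intro b hb
  rw [Finset.filter_image, Finset.card_image_of_injective _ σ.injective]
  simpa only [hde] using hdM b hb

theorem two_mul_card_of_mem_refiningPairPartitions (hM : M ∈ refiningPairPartitions P) :
    2 * M.card = Fintype.card I := by
  obtain ⟨hcard, -, hdisj, hcover⟩ := mem_refiningPairPartitions.1 hM
  rw [← Finset.card_univ, ← hcover, Finset.card_biUnion (t := id) hdisj]
  simp only [id]
  rw [Finset.sum_congr rfl hcard]
  simp [mul_comm]

theorem mem_balancedAssignments_of_mem_matchedAssignments (hM : M ∈ refiningPairPartitions P)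
    {d : I → Bool} (hd : d ∈ matchedAssignments M) : d ∈ balancedAssignments P := by
  obtain ⟨hcard, hsub, hdisj, hcover⟩ := mem_refiningPairPartitions.1 hM
  rw [mem_matchedAssignments] at hd
  refine mem_balancedAssignments.2 fun c hc => ?_
  have hunion : c = (M.filter (· ⊆ c)).biUnion fun b => b := by
    ext i
    simp only [Finset.mem_biUnion, Finset.mem_filter]
    refine ⟨fun hi => ?_, fun ⟨b, ⟨_, hbc⟩, hib⟩ => hbc hib⟩
    have hi' : i ∈ M.biUnion id := hcover ▸ Finset.mem_univ _
    obtain ⟨b, hb, hib⟩ := Finset.mem_biUnion.1 hi'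
    obtain ⟨c', hc', hbc'⟩ := hsub b hb
    rw [P.eq_of_mem_parts hc hc' hi (hbc' hib)]
    exact ⟨b, ⟨hb, hbc'⟩, hib⟩
  have hdisj' : ∀ b ∈ M.filter (· ⊆ c), ∀ b' ∈ M.filter (· ⊆ c), b ≠ b' → Disjoint b b' :=
    fun b hb b' hb' => hdisj b (Finset.mem_filter.1 hb).1 b' (Finset.mem_filter.1 hb').1
  have hleft : (c.filter fun i => d i = true).card = (M.filter (· ⊆ c)).card := by
    conv_lhs => rw [hunion]
    rw [Finset.filter_biUnion, Finset.card_biUnion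
      fun b hb b' hb' h => Finset.disjoint_filter_filter (hdisj' b hb b' hb' h),
      Finset.sum_congr rfl fun b hb => hd b (Finset.mem_filter.1 hb).1]
    simp
  have hright : c.card = (M.filter (· ⊆ c)).card * 2 := by
    conv_lhs => rw [hunion]
    rw [Finset.card_biUnion hdisj',
      Finset.sum_congr rfl fun b hb => hcard b (Finset.mem_filter.1 hb).1]
    simp
  omega

theorem card_matchedAssignments (hM : M ∈ refiningPairPartitions P) :
    (matchedAssignments M).card = 2 ^ M.card := by
  obtain ⟨hcard, -, hdisj, hcover⟩ := mem_refiningPairPartitions.1 hM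
  have hpair (b : M) : ∃ i j : I, i ≠ j ∧ b.1 = {i, j} := Finset.card_eq_two.1 (hcard b b.2)
  choose r s hrs hb using hpair
  have hblock (i : I) : ∃ b : M, i ∈ b.1 := by
    have hi : i ∈ M.biUnion id := hcover ▸ Finset.mem_univ _
    obtain ⟨b, hbM, hib⟩ := Finset.mem_biUnion.1 hi
    exact ⟨⟨b, hbM⟩, hib⟩
  choose p hp using hblock
  have hp_eq (i : I) (b : M) (hi : i ∈ b.1) : p i = b := by
    by_contra h
    exact Finset.disjoint_left.1 (hdisj _ (p i).2 _ b.2 fun h' => h (Subtype.ext h')) (hp i) hi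
  have hpr (b : M) : p (r b) = b := hp_eq _ _ (by rw [hb b]; simp)
  have hps (b : M) : p (s b) = b := hp_eq _ _ (by rw [hb b]; simp)
  have hmem (e : I → Bool) : e ∈ matchedAssignments M ↔ ∀ b : M, e (s b) = !e (r b) := by
    rw [mem_matchedAssignments, ← Subtype.forall (q := fun b : M =>
      (b.1.filter fun i => e i = true).card = 1)]
    refine forall_congr' fun b => ?_
    conv_lhs => rw [hb b]
    exact card_filter_pair_eq_one_iff (hrs b) e
  have hcases (i : I) : i = r (p i) ∨ i = s (p i) := by
    have := hp i
    rw [hb (p i)] at this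
    simpa using this
  have hfun : Fintype.card (M → Bool) = 2 ^ M.card := by simp
  rw [← hfun, ← Finset.card_univ]
  refine Finset.card_bij (fun e _ b => e (r b)) (fun _ _ => Finset.mem_univ _) ?_ ?_
  · intro e he f hf hef
    rw [hmem] at he hf
    funext i
    have hef' := congrFun hef (p i)
    rcases hcases i with h | h
    · rw [h]
      exact hef'
    · rw [h, he, hf, show e (r (p i)) = f (r (p i)) from hef']
  · intro g _
    refine ⟨fun i => if i = r (p i) then g (p i) else !g (p i), (hmem _).2 fun b => ?_, ?_⟩
    · simp [hpr, hps, (hrs b).symm]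
    · funext b
      simp [hpr]

/-- Double counting of the pairs consisting of a pair-partition and an assignment matched to it. -/
theorem card_mul_card_filter_mem_matchedAssignments {d : I → Bool}
    (hd : d ∈ balancedAssignments P) {n : ℕ} (hI : Fintype.card I = 2 * n) :
    (balancedAssignments P).card *
        ((refiningPairPartitions P).filter fun M => d ∈ matchedAssignments M).card =
      (refiningPairPartitions P).card * 2 ^ n := by
  have hcount := Finset.sum_card_bipartiteAbove_eq_sum_card_bipartiteBelow
    (s := balancedAssignments P) (t := refiningPairPartitions P)
    (fun e M => e ∈ matchedAssignments M)
  have hleft : ∀ e ∈ balancedAssignments P,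
      ((refiningPairPartitions P).bipartiteAbove (fun e M => e ∈ matchedAssignments M) e).card =
        ((refiningPairPartitions P).filter fun M => d ∈ matchedAssignments M).card :=
    fun e he => (card_filter_mem_matchedAssignments_le he hd).antisymm
      (card_filter_mem_matchedAssignments_le hd he)
  have hright : ∀ M ∈ refiningPairPartitions P,
      ((balancedAssignments P).bipartiteBelow (fun e M => e ∈ matchedAssignments M) M).card =
        2 ^ n := by
    intro M hM
    have hfilter : (balancedAssignments P).bipartiteBelow
        (fun e M => e ∈ matchedAssignments M) M = matchedAssignments M := by
      ext e
      rw [Finset.mem_bipartiteBelow]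
      exact ⟨And.right, fun he => ⟨mem_balancedAssignments_of_mem_matchedAssignments hM he, he⟩⟩
    have hMn := two_mul_card_of_mem_refiningPairPartitions hM
    rw [hfilter, card_matchedAssignments hM, show M.card = n by omega]
  rw [Finset.sum_congr rfl hleft, Finset.sum_congr rfl hright] at hcount
  simpa using hcount

end PairPartitions


/-- Any stratified randomization scheme with treated fraction one half in each (even-sized)
stratum is a uniform mixture of matched-pair designs: for every assignment `d`, the
probability of `d` under the stratified scheme (uniform on the assignments treating exactly
half of each stratum) equals the average, over all pair-partitions `M` refining the
stratification, of the probability of `d` under the matched-pair design based on `M`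
(uniform on the assignments treating exactly one unit of each pair). -/
theorem stmt_7 {I : Type*} [Fintype I] [DecidableEq I] (n : ℕ)
    (hI : Fintype.card I = 2 * n)
    (P : Finpartition (Finset.univ : Finset I))
    (hP : ∀ b ∈ P.parts, Even b.card)
    (d : I → Bool) :
    (if ∀ b ∈ P.parts, 2 * (b.filter fun i => d i = true).card = b.card then
        ((Finset.univ.filter fun e : I → Bool =>
            ∀ b ∈ P.parts, 2 * (b.filter fun i => e i = true).card = b.card).card : ℝ)⁻¹
      else 0) =
    ((Finset.univ.filter fun M : Finset (Finset I) =>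
        (∀ b ∈ M, b.card = 2) ∧ (∀ b ∈ M, ∃ c ∈ P.parts, b ⊆ c) ∧
          (∀ b ∈ M, ∀ c ∈ M, b ≠ c → Disjoint b c) ∧
          M.biUnion id = Finset.univ).card : ℝ)⁻¹ *
      ∑ M ∈ Finset.univ.filter (fun M : Finset (Finset I) =>
        (∀ b ∈ M, b.card = 2) ∧ (∀ b ∈ M, ∃ c ∈ P.parts, b ⊆ c) ∧
          (∀ b ∈ M, ∀ c ∈ M, b ≠ c → Disjoint b c) ∧
          M.biUnion id = Finset.univ),
        (if ∀ b ∈ M, (b.filter fun i => d i = true).card = 1 then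
            ((Finset.univ.filter fun e : I → Bool =>
                ∀ b ∈ M, (b.filter fun i => e i = true).card = 1).card : ℝ)⁻¹
          else 0) := by
  change (if ∀ b ∈ P.parts, 2 * (b.filter fun i => d i = true).card = b.card then
      ((balancedAssignments P).card : ℝ)⁻¹ else 0) =
    ((refiningPairPartitions P).card : ℝ)⁻¹ * ∑ M ∈ refiningPairPartitions P,
      (if ∀ b ∈ M, (b.filter fun i => d i = true).card = 1 then
        ((matchedAssignments M).card : ℝ)⁻¹ else 0)
  simp only [← mem_balancedAssignments, ← mem_matchedAssignments]
  split_ifs with hd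
  · have hT : ((refiningPairPartitions P).card : ℝ) ≠ 0 :=
      Nat.cast_ne_zero.2 (refiningPairPartitions_nonempty hd).card_pos.ne'
    have hS : ((balancedAssignments P).card : ℝ) ≠ 0 :=
      Nat.cast_ne_zero.2 (Finset.card_pos.2 ⟨d, hd⟩).ne'
    have hcount : ((balancedAssignments P).card : ℝ) *
        ((refiningPairPartitions P).filter fun M => d ∈ matchedAssignments M).card =
          (refiningPairPartitions P).card * 2 ^ n := by
      exact_mod_cast card_mul_card_filter_mem_matchedAssignments hd hI
    have hsize : ∀ M ∈ (refiningPairPartitions P).filter fun M => d ∈ matchedAssignments M,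
        ((matchedAssignments M).card : ℝ)⁻¹ = (2 ^ n)⁻¹ := by
      intro M hM
      have hM' := (Finset.mem_filter.1 hM).1
      have hMn := two_mul_card_of_mem_refiningPairPartitions hM'
      rw [card_matchedAssignments hM', show M.card = n by omega]
      norm_num
    rw [← Finset.sum_filter, Finset.sum_congr rfl hsize, Finset.sum_const, nsmul_eq_mul]
    field_simp
    linarith
  · rw [Finset.sum_eq_zero, mul_zero]
    exact fun M hM =>
      if_neg fun h => hd (mem_balancedAssignments_of_mem_matchedAssignments hM h)
end

section
/- Let k ≥ 2, n ≥ 1, and let g_1 ≤ g_2 ≤ ⋯ ≤ g_{kn} be real numbers. For a partition {B_1, …, B_n} of {1, …, kn} into n blocks each of cardinality k, define W = ∑_{s=1}^{n} ∑_{j ∈ B_s} (g_j − ḡ_{B_s})², where ḡ_{B_s} = (1/k) ∑_{j ∈ B_s} g_j. Then W is minimized, over all partitions of {1, …, kn} into n blocks of size k, by the partition into consecutive blocks B_s = {(s−1)k + 1, …, sk}. -/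
open Finset in
/-- Grouping a weighted sum by the fibres of `b`, with weights constant on each fibre. -/
lemma sum_mul_comp_eq_sum_fiber {ι κ : Type*} [Fintype ι] [Fintype κ] [DecidableEq κ]
    (b : ι → κ) (g : ι → ℝ) (w : κ → ℝ) :
    ∑ j, g j * w (b j) = ∑ s, (∑ j with b j = s, g j) * w s := by
  rw [← sum_fiberwise univ b]
  refine sum_congr rfl fun s _ => ?_
  rw [sum_mul]
  refine sum_congr rfl fun j hj => ?_
  rw [(mem_filter.1 hj).2]

open Finset in
/-- If `b` and `c` have equinumerous fibres of constant size and `c` is monotone, the sum of the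
squared fibre sums of a monotone function is at least as large for `c` as for `b`. -/
lemma sum_sq_fiber_sum_le {ι : Type*} [Fintype ι] [LinearOrder ι] {n k : ℕ}
    {g : ι → ℝ} (hg : Monotone g) {b c : ι → Fin n} (hc : Monotone c)
    (hbk : ∀ s, #{j | b j = s} = k) (hck : ∀ s, #{j | c j = s} = k) :
    ∑ s, (∑ j with b j = s, g j) ^ 2 ≤ ∑ s, (∑ j with c j = s, g j) ^ 2 := by
  let S : Fin n → ℝ := fun s => ∑ j with b j = s, g j
  let C : Fin n → ℝ := fun s => ∑ j with c j = s, g j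
  let σ := Tuple.sort S
  have hσ : Monotone (S ∘ σ) := Tuple.monotone_sort S
  have e : ∀ s, Nonempty ({j // σ (c j) = s} ≃ {j // b j = s}) := fun s => by
    refine ⟨Fintype.equivOfCardEq ?_⟩
    simp only [Fintype.card_subtype, hbk]
    rw [← hck (σ.symm s)]
    simp only [Equiv.eq_symm_apply]
  let π : Equiv.Perm ι := Equiv.ofFiberEquiv fun s => (e s).some
  have hπ : ∀ j, b (π j) = σ (c j) := Equiv.ofFiberEquiv_map _
  have hmono : Monovary g (S ∘ σ ∘ c) := hg.monovary (hσ.comp hc)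
  have key : ∑ s, S s ^ 2 ≤ ∑ s, C s * S (σ s) :=
    calc ∑ s, S s ^ 2 = ∑ j, g j * S (b j) := by
          rw [sum_mul_comp_eq_sum_fiber b g S]
          exact sum_congr rfl fun s _ => sq (S s)
      _ = ∑ j, g (π j) * S (σ (c j)) := by
          simp only [← Equiv.sum_comp π (fun j => g j * S (b j)), hπ]
      _ ≤ ∑ j, g j * S (σ (c j)) := hmono.sum_comp_perm_mul_le_sum_mul
      _ = ∑ s, C s * S (σ s) := sum_mul_comp_eq_sum_fiber c g (S ∘ σ)
  have amgm : 2 * ∑ s, C s * S (σ s) ≤ ∑ s, C s ^ 2 + ∑ s, S s ^ 2 := by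
    rw [← Equiv.sum_comp σ (fun s => S s ^ 2), ← sum_add_distrib, mul_sum]
    exact sum_le_sum fun s _ => by linarith [two_mul_le_add_sq (C s) (S (σ s))]
  linarith

open Finset in
/-- The within-block sum of squares is the total sum of squares minus the block-mean part. -/
lemma sum_sq_sub_mean_eq {ι κ : Type*} [Fintype ι] [Fintype κ] [DecidableEq κ] {k : ℕ}
    (hk : k ≠ 0) (g : ι → ℝ) (b : ι → κ) (hbk : ∀ s, #{j | b j = s} = k) :
    ∑ s, ∑ j with b j = s, (g j - (∑ j' with b j' = s, g j') / k) ^ 2 =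
      ∑ j, g j ^ 2 - (∑ s, (∑ j with b j = s, g j) ^ 2) / k := by
  have hk' : (k : ℝ) ≠ 0 := Nat.cast_ne_zero.2 hk
  rw [← sum_fiberwise univ b (fun j => g j ^ 2), sum_div, ← sum_sub_distrib]
  refine sum_congr rfl fun s _ => ?_
  simp only [sub_sq, sum_add_distrib, sum_sub_distrib, sum_const, hbk, nsmul_eq_mul,
    ← sum_mul, ← mul_sum]
  field_simp
  ring

open Finset in
lemma card_filter_val_div_eq {k n : ℕ} (hk : 0 < k) (s : Fin n) :
    #{j : Fin (k * n) | j.1 / k = s.1} = k := by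
  have h : ({j : Fin (k * n) | j.1 / k = s.1} : Finset _).map Fin.valEmbedding =
      Ico (s.1 * k) (s.1 * k + k) := by
    ext m
    simp only [mem_map, mem_filter, mem_univ, true_and, Fin.valEmbedding_apply, mem_Ico]
    have hm : m / k = s.1 ↔ s.1 * k ≤ m ∧ m < s.1 * k + k := by
      rw [Nat.div_eq_iff hk]
      omega
    rw [← hm]
    constructor
    · rintro ⟨j, hj, rfl⟩
      exact hj
    · intro h
      have hlt : m < k * n := by
        rw [mul_comm]
        exact (Nat.div_lt_iff_lt_mul hk).1 (h ▸ s.2)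
      exact ⟨⟨m, hlt⟩, h, rfl⟩
  rw [← card_map Fin.valEmbedding, h, Nat.card_Ico, Nat.add_sub_cancel_left]


/-- Among all partitions of `k*n` sorted real numbers into `n` blocks of size `k`, the
partition into consecutive blocks minimizes the total within-block sum of squared
deviations from the block means. -/
theorem stmt_15 (k n : ℕ) (hk : 2 ≤ k) (hn : 1 ≤ n)
    (g : Fin (k * n) → ℝ) (hg : Monotone g)
    (B : Fin n → Finset (Fin (k * n)))
    (hcard : ∀ s, (B s).card = k)
    (hdisj : ∀ s t, s ≠ t → Disjoint (B s) (B t))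
    (hcover : ∀ j, ∃ s, j ∈ B s) :
    ∑ s : Fin n, ∑ j ∈ Finset.univ.filter (fun j : Fin (k * n) => j.1 / k = s.1),
        (g j - (∑ j' ∈ Finset.univ.filter (fun j' : Fin (k * n) => j'.1 / k = s.1), g j') /
          k) ^ 2 ≤
      ∑ s : Fin n, ∑ j ∈ B s, (g j - (∑ j' ∈ B s, g j') / k) ^ 2 := by
  have hk0 : 0 < k := by omega
  choose b hb using hcover
  have hB : ∀ s, B s = Finset.univ.filter (fun j => b j = s) := fun s => by
    ext j
    simp only [Finset.mem_filter, Finset.mem_univ, true_and]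
    refine ⟨fun hj => ?_, fun h => h ▸ hb j⟩
    by_contra hne
    exact Finset.disjoint_left.1 (hdisj _ _ hne) (hb j) hj
  let c : Fin (k * n) → Fin n := fun j => ⟨j.1 / k, Nat.div_lt_of_lt_mul j.2⟩
  have hc : Monotone c := fun i j hij => Nat.div_le_div_right hij
  have hcs : ∀ (s : Fin n) (j : Fin (k * n)), j.1 / k = s.1 ↔ c j = s := fun s j =>
    (Fin.ext_iff (a := c j)).symm
  have hck : ∀ s, (Finset.univ.filter (fun j => c j = s)).card = k := fun s => by
    simp only [← hcs, card_filter_val_div_eq hk0]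
  have hbk : ∀ s, (Finset.univ.filter (fun j => b j = s)).card = k := fun s => by
    rw [← hB, hcard]
  simp only [hB, hcs]
  rw [sum_sq_sub_mean_eq hk0.ne' g b hbk, sum_sq_sub_mean_eq hk0.ne' g c hck]
  gcongr ?_ - ?_ / _
  exact sum_sq_fiber_sum_le hg hc hbk hck
end

section
/- Let n ≥ 2 be even, let Y : {1, …, 2n} → ℝ, let D : {1, …, 2n} → {0,1}, and let π be a permutation of {1, …, 2n} such that D_{π(2s−1)} + D_{π(2s)} = 1 for every 1 ≤ s ≤ n (exactly one unit of each pair is treated, so exactly n units are treated in total). Define μ̂(d) = (1/n) ∑_{i : D_i = d} Y_i and σ̂²(d) = (1/n) ∑_{i : D_i = d} (Y_i − μ̂(d))² for d ∈ {0,1}, and ρ̂ = (2/n) ∑_{j=1}^{n/2} (Y_{π(4j−3)} + Y_{π(4j−2)})(Y_{π(4j−1)} + Y_{π(4j)}). Then the adjusted variance estimator ς̂² = σ̂²(1) + σ̂²(0) − (1/2) ρ̂ + (1/2)(μ̂(1) + μ̂(0))² is nonnegative; indeed, it equals one half the empirical variance of the pair differences (D_{π(2s−1)} − D_{π(2s)})(Y_{π(2s−1)}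 − Y_{π(2s)}), 1 ≤ s ≤ n, plus (1/(2n)) ∑_{j=1}^{n/2} (Y_{π(4j−3)} + Y_{π(4j−2)} − Y_{π(4j−1)} − Y_{π(4j)})². -/
/-- The sample mean of outcomes among units with treatment status `d`. -/
noncomputable def muHat (n : ℕ) (Y D : Fin (2 * n) → ℝ) (d : ℝ) : ℝ :=
  (1 / (n : ℝ)) * ∑ i ∈ Finset.univ.filter (fun i => D i = d), Y i

/-- The sample variance (divided by `n`) of outcomes among units with status `d`. -/
noncomputable def sigmaHat2 (n : ℕ) (Y D : Fin (2 * n) → ℝ) (d : ℝ) : ℝ :=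
  (1 / (n : ℝ)) * ∑ i ∈ Finset.univ.filter (fun i => D i = d), (Y i - muHat n Y D d) ^ 2

/-- The pairs-of-adjacent-pairs cross-product correction `ρ̂`. -/
noncomputable def rhoHat (n : ℕ) (Y : Fin (2 * n) → ℝ) (π : Equiv.Perm (Fin (2 * n))) : ℝ :=
  (2 / (n : ℝ)) * ∑ j : Fin (n / 2),
    (Y (π ⟨4 * j.1, by have := j.isLt; omega⟩) +
        Y (π ⟨4 * j.1 + 1, by have := j.isLt; omega⟩)) *
      (Y (π ⟨4 * j.1 + 2, by have := j.isLt; omega⟩) +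
        Y (π ⟨4 * j.1 + 3, by have := j.isLt; omega⟩))

/-- A sum over `Fin (2 * m)` grouped into consecutive pairs. -/
theorem Fin.sum_univ_pairs {M : Type*} [AddCommMonoid M] {m n : ℕ} (h : n = 2 * m)
    (f : Fin n → M) :
    ∑ i, f i = ∑ s : Fin m, (f ⟨2 * s.1, by have := s.isLt; omega⟩ +
      f ⟨2 * s.1 + 1, by have := s.isLt; omega⟩) := by
  subst h
  induction m with
  | zero => simp
  | succ m ih =>
    rw [Fin.sum_univ_castSucc (n := m)]
    change ∑ i : Fin (2 * m + 1 + 1), f i = _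
    rw [Fin.sum_univ_castSucc, Fin.sum_univ_castSucc, ih, add_assoc]
    rfl

/-- The mean of squared deviations from the mean, over a finset of cardinality `n`. -/
theorem mean_sq_sub_mean {ι : Type*} (S : Finset ι) (f : ι → ℝ) {n : ℝ} (hn : n ≠ 0)
    (hS : ∑ _i ∈ S, (1 : ℝ) = n) :
    (1 / n) * ∑ i ∈ S, (f i - (1 / n) * ∑ k ∈ S, f k) ^ 2 =
      (1 / n) * ∑ i ∈ S, f i ^ 2 - ((1 / n) * ∑ i ∈ S, f i) ^ 2 := by
  set c := (1 / n) * ∑ k ∈ S, f k with hc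
  have hsum : ∑ k ∈ S, f k = n * c := by rw [hc]; field_simp
  have hexp : ∑ i ∈ S, (f i - c) ^ 2 =
      ∑ i ∈ S, f i ^ 2 - 2 * c * ∑ i ∈ S, f i + c ^ 2 * ∑ _i ∈ S, (1 : ℝ) := by
    rw [Finset.mul_sum, Finset.mul_sum, ← Finset.sum_sub_distrib, ← Finset.sum_add_distrib]
    exact Finset.sum_congr rfl fun i _ => by ring
  rw [hexp, hS, hsum]
  field_simp
  ring

/-- Averages of squares dominate squares of averages over `Fin n`. -/
theorem sq_mean_le_mean_sq {n : ℕ} (hn : n ≠ 0) (f : Fin n → ℝ) :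
    ((1 / (n : ℝ)) * ∑ s, f s) ^ 2 ≤ (1 / (n : ℝ)) * ∑ s, f s ^ 2 := by
  have h := mean_sq_sub_mean Finset.univ f (n := (n : ℝ)) (by exact_mod_cast hn) (by simp)
  have hnonneg : 0 ≤ (1 / (n : ℝ)) * ∑ i, (f i - (1 / (n : ℝ)) * ∑ k, f k) ^ 2 := by positivity
  linarith

/-- A sum over the treated units, grouped into pairs. -/
theorem sum_treated_eq_sum_pairs {m n : ℕ} (h : n = 2 * m) (D : Fin n → ℝ)
    (hD : ∀ i, D i = 0 ∨ D i = 1) (π : Equiv.Perm (Fin n)) (f : Fin n → ℝ) :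
    ∑ i ∈ Finset.univ.filter (fun i => D i = 1), f i =
      ∑ s : Fin m, (D (π ⟨2 * s.1, by have := s.isLt; omega⟩) *
          f (π ⟨2 * s.1, by have := s.isLt; omega⟩) +
        D (π ⟨2 * s.1 + 1, by have := s.isLt; omega⟩) *
          f (π ⟨2 * s.1 + 1, by have := s.isLt; omega⟩)) := by
  rw [← Fin.sum_univ_pairs h fun i => D (π i) * f (π i),
    Equiv.sum_comp π fun i => D i * f i, Finset.sum_filter]
  exact Finset.sum_congr rfl fun i _ => by rcases hD i with h | h <;> simp [h]

/-- A sum over the control units, grouped into pairs. -/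
theorem sum_control_eq_sum_pairs {m n : ℕ} (h : n = 2 * m) (D : Fin n → ℝ)
    (hD : ∀ i, D i = 0 ∨ D i = 1) (π : Equiv.Perm (Fin n)) (f : Fin n → ℝ) :
    ∑ i ∈ Finset.univ.filter (fun i => D i = 0), f i =
      ∑ s : Fin m, ((1 - D (π ⟨2 * s.1, by have := s.isLt; omega⟩)) *
          f (π ⟨2 * s.1, by have := s.isLt; omega⟩) +
        (1 - D (π ⟨2 * s.1 + 1, by have := s.isLt; omega⟩)) *
          f (π ⟨2 * s.1 + 1, by have := s.isLt; omega⟩)) := by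
  rw [← sum_treated_eq_sum_pairs h (fun i => 1 - D i)
    (fun i => by rcases hD i with h | h <;> simp [h]) π f]
  simp

/-- The adjusted variance estimator equals one half the empirical variance of the pair
differences plus an average of squares; in particular it is nonnegative. -/
theorem stmt_17 (n : ℕ) (hn : 2 ≤ n) (heven : Even n)
    (Y D : Fin (2 * n) → ℝ)
    (hD : ∀ i, D i = 0 ∨ D i = 1)
    (π : Equiv.Perm (Fin (2 * n)))
    (hpair : ∀ s : Fin n, D (π ⟨2 * s.1, by have := s.isLt; omega⟩) +
      D (π ⟨2 * s.1 + 1, by have := s.isLt; omega⟩) = 1) :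
    (sigmaHat2 n Y D 1 + sigmaHat2 n Y D 0 - (1 / 2) * rhoHat n Y π +
        (1 / 2) * (muHat n Y D 1 + muHat n Y D 0) ^ 2 =
      (1 / 2) * ((1 / (n : ℝ)) * ∑ s : Fin n,
          ((D (π ⟨2 * s.1, by have := s.isLt; omega⟩) -
              D (π ⟨2 * s.1 + 1, by have := s.isLt; omega⟩)) *
            (Y (π ⟨2 * s.1, by have := s.isLt; omega⟩) -
              Y (π ⟨2 * s.1 + 1, by have := s.isLt; omega⟩))) ^ 2 -
        ((1 / (n : ℝ)) * ∑ s : Fin n,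
          (D (π ⟨2 * s.1, by have := s.isLt; omega⟩) -
              D (π ⟨2 * s.1 + 1, by have := s.isLt; omega⟩)) *
            (Y (π ⟨2 * s.1, by have := s.isLt; omega⟩) -
              Y (π ⟨2 * s.1 + 1, by have := s.isLt; omega⟩))) ^ 2) +
      (1 / (2 * (n : ℝ))) * ∑ j : Fin (n / 2),
        (Y (π ⟨4 * j.1, by have := j.isLt; omega⟩) +
            Y (π ⟨4 * j.1 + 1, by have := j.isLt; omega⟩) -
          (Y (π ⟨4 * j.1 + 2, by have := j.isLt; omega⟩) +
            Y (π ⟨4 * j.1 + 3, by have := j.isLt; omega⟩))) ^ 2) ∧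
    0 ≤ sigmaHat2 n Y D 1 + sigmaHat2 n Y D 0 - (1 / 2) * rhoHat n Y π +
        (1 / 2) * (muHat n Y D 1 + muHat n Y D 0) ^ 2 := by
  have hn0 : (n : ℝ) ≠ 0 := by positivity
  have hcard1 : ∑ _i ∈ Finset.univ.filter (fun i => D i = 1), (1 : ℝ) = n := by
    rw [sum_treated_eq_sum_pairs rfl D hD π]
    simp [hpair]
  have hcard0 : ∑ _i ∈ Finset.univ.filter (fun i => D i = 0), (1 : ℝ) = n := by
    rw [sum_control_eq_sum_pairs rfl D hD π, Finset.sum_congr rfl (g := fun _ => (1 : ℝ))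
      fun s _ => by linarith [hpair s]]
    simp
  have hσ1 : sigmaHat2 n Y D 1 = (1 / (n : ℝ)) * ∑ i ∈ Finset.univ.filter (fun i => D i = 1),
      Y i ^ 2 - muHat n Y D 1 ^ 2 := mean_sq_sub_mean _ Y hn0 hcard1
  have hσ0 : sigmaHat2 n Y D 0 = (1 / (n : ℝ)) * ∑ i ∈ Finset.univ.filter (fun i => D i = 0),
      Y i ^ 2 - muHat n Y D 0 ^ 2 := mean_sq_sub_mean _ Y hn0 hcard0
  let a : Fin n → ℝ := fun s => Y (π ⟨2 * s.1, by have := s.isLt; omega⟩)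
  let b : Fin n → ℝ := fun s => Y (π ⟨2 * s.1 + 1, by have := s.isLt; omega⟩)
  let t : Fin n → ℝ := fun s => D (π ⟨2 * s.1, by have := s.isLt; omega⟩)
  let u : Fin n → ℝ := fun s => D (π ⟨2 * s.1 + 1, by have := s.isLt; omega⟩)
  have hu (s : Fin n) : u s = 1 - t s := eq_sub_of_add_eq' (hpair s)
  have ht (s : Fin n) : t s = 0 ∨ t s = 1 := hD _
  have hdiff : muHat n Y D 1 - muHat n Y D 0 =
      (1 / (n : ℝ)) * ∑ s, (t s - u s) * (a s - b s) := by
    rw [muHat, muHat, sum_treated_eq_sum_pairs rfl D hD π, sum_control_eq_sum_pairs rfl D hD π,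
      ← mul_sub, ← Finset.sum_sub_distrib]
    congr 1
    refine Finset.sum_congr rfl fun s _ => ?_
    change t s * a s + u s * b s - ((1 - t s) * a s + (1 - u s) * b s) = _
    rw [hu]
    ring
  have hsq : ∑ i ∈ Finset.univ.filter (fun i => D i = 1), Y i ^ 2 +
      ∑ i ∈ Finset.univ.filter (fun i => D i = 0), Y i ^ 2 =
      (1 / 2) * (∑ s, ((t s - u s) * (a s - b s)) ^ 2 + ∑ s, (a s + b s) ^ 2) := by
    rw [sum_treated_eq_sum_pairs rfl D hD π, sum_control_eq_sum_pairs rfl D hD π,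
      ← Finset.sum_add_distrib, ← Finset.sum_add_distrib, Finset.mul_sum]
    refine Finset.sum_congr rfl fun s _ => ?_
    change t s * a s ^ 2 + u s * b s ^ 2 + ((1 - t s) * a s ^ 2 + (1 - u s) * b s ^ 2) = _
    rw [hu]
    rcases ht s with h | h <;> rw [h] <;> ring
  let A : Fin (n / 2) → ℝ := fun j => Y (π ⟨4 * j.1, by have := j.isLt; omega⟩) +
    Y (π ⟨4 * j.1 + 1, by have := j.isLt; omega⟩)
  let B : Fin (n / 2) → ℝ := fun j => Y (π ⟨4 * j.1 + 2, by have := j.isLt; omega⟩) +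
    Y (π ⟨4 * j.1 + 3, by have := j.isLt; omega⟩)
  have hAB : ∑ s, (a s + b s) ^ 2 = ∑ j, (A j - B j) ^ 2 + 2 * ∑ j, A j * B j := by
    rw [Fin.sum_univ_pairs (m := n / 2) (Nat.two_mul_div_two_of_even heven).symm,
      Finset.mul_sum, ← Finset.sum_add_distrib]
    refine Finset.sum_congr rfl fun j _ => ?_
    have e0 : 2 * (2 * j.1) = 4 * j.1 := by ring
    have e2 : 2 * (2 * j.1 + 1) = 4 * j.1 + 2 := by ring
    simp only [a, b, A, B, e0, e2]
    ring
  have hρ : rhoHat n Y π = (2 / (n : ℝ)) * ∑ j, A j * B j := rfl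
  have key : sigmaHat2 n Y D 1 + sigmaHat2 n Y D 0 - (1 / 2) * rhoHat n Y π +
        (1 / 2) * (muHat n Y D 1 + muHat n Y D 0) ^ 2 =
      (1 / 2) * ((1 / (n : ℝ)) * ∑ s, ((t s - u s) * (a s - b s)) ^ 2 -
        ((1 / (n : ℝ)) * ∑ s, (t s - u s) * (a s - b s)) ^ 2) +
      (1 / (2 * (n : ℝ))) * ∑ j, (A j - B j) ^ 2 := by
    rw [hσ1, hσ0, hρ, ← hdiff]
    rw [hAB] at hsq
    linear_combination (1 / (n : ℝ)) * hsq
  refine ⟨key, ?_⟩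
  rw [key]
  have hvar := sq_mean_le_mean_sq (by omega) fun s => (t s - u s) * (a s - b s)
  have hsquares : 0 ≤ (1 / (2 * (n : ℝ))) * ∑ j, (A j - B j) ^ 2 := by positivity
  linarith
end
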